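/- arXiv:math/0011052 — 2 statements merged into one kernel-verified Lean document; each statement's English description precedes it below -/
import Mathlib

section
/- For every integer k ≥ 1, lim_{n→∞} n^{−k/2} · Σ_{(l_1,…,l_k)} 1/√(l_1 l_2 ⋯ l_k) = ω_k, where the sum runs over all integer vectors (l_1, …, l_k) with l_i ≥ 1 for all i and l_1 + ⋯ + l_k ≤ n. Consequently, the k-th intrinsic volume of the convex hull of a discretized crinkled arc, (1/√n)^k · (1/k!) · Σ_{(l_1,…,l_k)} 1/√(l_1 ⋯ l_k), converges to ω_k/k! as n → ∞. -/
open Filter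
open scoped Topology

/-- `ω_k = π^{k/2} / Γ(k/2 + 1)`, the volume of the `k`-dimensional unit ball. -/
noncomputable def unitBallVol (k : ℕ) : ℝ :=
  Real.pi ^ ((k : ℝ) / 2) / Real.Gamma ((k : ℝ) / 2 + 1)

/-- `Σ 1/√(l_1 ⋯ l_k)` over integer vectors `(l_1,…,l_k)` with `l_i ≥ 1` and `Σ l_i ≤ n`. -/
noncomputable def sqrtRecipSum (k n : ℕ) : ℝ :=
  ∑ l ∈ Finset.univ.filter (fun l : Fin k → Fin (n + 1) =>
      (∀ i, 1 ≤ (l i : ℕ)) ∧ ∑ i, (l i : ℕ) ≤ n),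
    1 / Real.sqrt (∏ i, ((l i : ℕ) : ℝ))

open MeasureTheory

/-- The sums of `1/√(l_1 ⋯ l_k)` over `l_i ≥ 1`, `Σ l_i ≤ n`, defined by splitting off one
variable. -/
noncomputable def sqrtRecipSumRec : ℕ → ℕ → ℝ
  | 0, _ => 1
  | k + 1, n => ∑ l ∈ Finset.range n, 1 / √((l : ℝ) + 1) * sqrtRecipSumRec k (n - 1 - l)

theorem sum_fin_fun_eq_sqrtRecipSumRec (k N n : ℕ) (hn : n ≤ N) :
    ∑ l : Fin k → Fin (N + 1),
      (if (∀ i, 1 ≤ (l i : ℕ)) ∧ ∑ i, (l i : ℕ) ≤ n then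
        1 / √(∏ i, ((l i : ℕ) : ℝ)) else 0) = sqrtRecipSumRec k n := by
  induction k generalizing n with
  | zero => simp [sqrtRecipSumRec]
  | succ k ih =>
    rw [← (Fin.consEquiv fun _ : Fin (k + 1) => Fin (N + 1)).sum_comp, Fintype.sum_prod_type]
    have key : ∀ a : Fin (N + 1),
        ∑ y : Fin k → Fin (N + 1),
          (if (∀ i, 1 ≤ ((Fin.consEquiv fun _ : Fin (k + 1) => Fin (N + 1)) (a, y) i : ℕ)) ∧
              ∑ i, ((Fin.consEquiv fun _ : Fin (k + 1) => Fin (N + 1)) (a, y) i : ℕ) ≤ n then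
            1 / √(∏ i, (((Fin.consEquiv fun _ : Fin (k + 1) => Fin (N + 1)) (a, y) i : ℕ) : ℝ))
            else 0) =
          if 1 ≤ (a : ℕ) ∧ (a : ℕ) ≤ n then
            1 / √((a : ℕ) : ℝ) * sqrtRecipSumRec k (n - a) else 0 := by
      intro a
      split_ifs with h
      · rw [← ih (n - a) (by omega), Finset.mul_sum]
        refine Finset.sum_congr rfl fun y _ => ?_
        have hc : ((∀ i, 1 ≤ ((Fin.consEquiv fun _ : Fin (k + 1) => Fin (N + 1)) (a, y) i : ℕ)) ∧
            ∑ i, ((Fin.consEquiv fun _ : Fin (k + 1) => Fin (N + 1)) (a, y) i : ℕ) ≤ n) ↔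
            ((∀ i, 1 ≤ (y i : ℕ)) ∧ ∑ i, (y i : ℕ) ≤ n - a) := by
          simp only [Fin.consEquiv_apply, Fin.forall_fin_succ, Fin.sum_univ_succ, Fin.cons_zero,
            Fin.cons_succ]
          constructor
          · rintro ⟨⟨_, h2⟩, h3⟩
            exact ⟨h2, by omega⟩
          · rintro ⟨h2, h3⟩
            exact ⟨⟨h.1, h2⟩, by omega⟩
        rw [if_congr hc rfl rfl]
        simp only [Fin.consEquiv_apply, Fin.prod_univ_succ, Fin.cons_zero, Fin.cons_succ,
          mul_ite, mul_zero]
        rw [Real.sqrt_mul (Nat.cast_nonneg _), one_div_mul_one_div]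
      · refine Finset.sum_eq_zero fun y _ => if_neg fun hy => h ?_
        simp only [Fin.consEquiv_apply, Fin.forall_fin_succ, Fin.sum_univ_succ, Fin.cons_zero,
          Fin.cons_succ] at hy
        exact ⟨hy.1.1, by omega⟩
    rw [Finset.sum_congr rfl fun a _ => key a,
      Fin.sum_univ_eq_sum_range (fun a : ℕ => if 1 ≤ a ∧ a ≤ n then
        1 / √(a : ℝ) * sqrtRecipSumRec k (n - a) else 0), Finset.sum_range_succ', sqrtRecipSumRec]
    rw [if_neg (by omega), add_zero]
    symm
    refine Finset.sum_subset_zero_on_sdiff (Finset.range_mono hn) (fun l hl => ?_) fun l hl => ?_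
    · simp only [Finset.mem_sdiff, Finset.mem_range] at hl
      exact if_neg (by omega)
    · rw [Finset.mem_range] at hl
      rw [if_pos (by omega), Nat.cast_succ, show n - 1 - l = n - (l + 1) by omega]

theorem sqrtRecipSum_eq_sqrtRecipSumRec (k n : ℕ) :
    sqrtRecipSum k n = sqrtRecipSumRec k n := by
  rw [sqrtRecipSum, Finset.sum_filter, sum_fin_fun_eq_sqrtRecipSumRec k n n le_rfl]

theorem floor_natCast_mul_of_mem_Ioo {n i : ℕ} (hn : 0 < n) {x : ℝ}
    (hx : x ∈ Set.Ioo ((i : ℝ) / n) (((i + 1 : ℕ) : ℝ) / n)) : ⌊(n : ℝ) * x⌋₊ = i := by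
  have hn' : (0 : ℝ) < n := Nat.cast_pos.2 hn
  obtain ⟨h1, h2⟩ := hx
  rw [div_lt_iff₀ hn'] at h1
  rw [lt_div_iff₀ hn', Nat.cast_succ] at h2
  rw [Nat.floor_eq_iff (by nlinarith [(Nat.cast_nonneg i : (0 : ℝ) ≤ i)])]
  constructor <;> linarith

/-- An average of `n` terms as the integral of a step function. -/
theorem integral_floor_natCast_mul {n : ℕ} (hn : 0 < n) (F : ℕ → ℝ) :
    ∫ x in (0 : ℝ)..1, F ⌊(n : ℝ) * x⌋₊ = (∑ i ∈ Finset.range n, F i) / n := by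
  have hn' : (0 : ℝ) < n := Nat.cast_pos.2 hn
  have hle : ∀ i : ℕ, (i : ℝ) / n ≤ ((i + 1 : ℕ) : ℝ) / n := fun i => by
    gcongr; exact Nat.le_succ i
  have heq : ∀ i : ℕ, Set.EqOn (fun _ : ℝ => F i) (fun x : ℝ => F ⌊(n : ℝ) * x⌋₊)
      (Set.Ioo ((i : ℝ) / n) (((i + 1 : ℕ) : ℝ) / n)) := fun i x hx => by
    simp only [floor_natCast_mul_of_mem_Ioo hn hx]
  have h := intervalIntegral.sum_integral_adjacent_intervals (μ := volume)
    (f := fun x : ℝ => F ⌊(n : ℝ) * x⌋₊) (a := fun i : ℕ => (i : ℝ) / n) (n := n) fun i _ => by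
      refine IntervalIntegrable.congr_uIoo (f := fun _ => F i) intervalIntegrable_const ?_
      rw [Set.uIoo_of_le (hle i)]
      exact heq i
  simp only [Nat.cast_zero, zero_div, div_self hn'.ne'] at h
  rw [← h, Finset.sum_div]
  refine Finset.sum_congr rfl fun i _ => ?_
  rw [← intervalIntegral.integral_congr_Ioo_of_le (hle i) (heq i),
    intervalIntegral.integral_const, smul_eq_mul, Nat.cast_succ]
  ring

theorem integral_one_div_sqrt_mul_one_sub_rpow {a : ℝ} (ha : 0 ≤ a) :
    ∫ x in (0 : ℝ)..1, 1 / √x * (1 - x) ^ a = ProbabilityTheory.beta (1 / 2) (a + 1) := by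
  rw [ProbabilityTheory.beta_eq_betaIntegralReal _ _ (by norm_num) (by linarith),
    Complex.betaIntegral, ← Complex.ofReal_re (∫ x in (0 : ℝ)..1, 1 / √x * (1 - x) ^ a),
    ← intervalIntegral.integral_ofReal]
  congr 1
  refine intervalIntegral.integral_congr_Ioo_of_le zero_le_one fun x hx => ?_
  have h1 : 1 / √x = x ^ ((1 : ℝ) / 2 - 1) := by
    rw [Real.sqrt_eq_rpow, one_div, ← Real.rpow_neg hx.1.le]
    norm_num
  have h2 : (0 : ℝ) ≤ 1 - x := by linarith [hx.2]
  simp only [h1, Complex.ofReal_mul, Complex.ofReal_cpow hx.1.le, Complex.ofReal_cpow h2]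
  push_cast
  simp

theorem intervalIntegrable_one_div_sqrt :
    IntervalIntegrable (fun x : ℝ => 1 / √x) volume 0 1 := by
  have h : IntervalIntegrable (fun x : ℝ => x ^ (-(1 / 2) : ℝ)) volume 0 1 :=
    intervalIntegral.intervalIntegrable_rpow' (by norm_num)
  refine h.congr_uIoo fun x hx => ?_
  rw [Set.uIoo_of_le zero_le_one] at hx
  simp only [Real.sqrt_eq_rpow, one_div, Real.rpow_neg hx.1.le]

theorem exists_abs_le_mul_rpow {u : ℕ → ℝ} {a c : ℝ} (ha : 0 ≤ a)
    (hu : Tendsto (fun n : ℕ => u n / (n : ℝ) ^ a) atTop (𝓝 c)) :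
    ∃ M, 0 ≤ M ∧ ∀ n m : ℕ, 0 < n → m ≤ n → |u m| ≤ M * (n : ℝ) ^ a := by
  obtain ⟨M, hM⟩ := hu.abs.bddAbove_range
  have hM' : ∀ m : ℕ, |u m / (m : ℝ) ^ a| ≤ M := fun m => hM ⟨m, rfl⟩
  have hM0 : 0 ≤ M := (abs_nonneg _).trans (hM' 0)
  refine ⟨M + |u 0|, by positivity, fun n m hn hmn => ?_⟩
  have h1 : (1 : ℝ) ≤ (n : ℝ) ^ a := Real.one_le_rpow (by exact_mod_cast hn) ha
  rcases Nat.eq_zero_or_pos m with rfl | hm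
  · nlinarith [abs_nonneg (u 0)]
  · have hm' : (0 : ℝ) < (m : ℝ) ^ a := Real.rpow_pos_of_pos (by exact_mod_cast hm) a
    have h2 := hM' m
    rw [abs_div, abs_of_pos hm', div_le_iff₀ hm'] at h2
    have h3 : (m : ℝ) ^ a ≤ (n : ℝ) ^ a := by gcongr
    nlinarith [abs_nonneg (u 0)]

/-- Convolving a sequence asymptotic to `c n ^ a` with `1 / √n`. -/
theorem tendsto_sum_one_div_sqrt_mul {u : ℕ → ℝ} {a c : ℝ} (ha : 0 ≤ a)
    (hu : Tendsto (fun n : ℕ => u n / (n : ℝ) ^ a) atTop (𝓝 c)) :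
    Tendsto (fun n : ℕ => (∑ l ∈ Finset.range n, 1 / √((l : ℝ) + 1) * u (n - 1 - l)) /
      (n : ℝ) ^ (a + 1 / 2)) atTop (𝓝 (c * ProbabilityTheory.beta (1 / 2) (a + 1))) := by
  obtain ⟨M, hM0, hM⟩ := exists_abs_le_mul_rpow ha hu
  rw [← integral_one_div_sqrt_mul_one_sub_rpow ha, ← intervalIntegral.integral_const_mul]
  let F : ℕ → ℕ → ℝ := fun n l => 1 / √(((l : ℝ) + 1) / n) * (u (n - 1 - l) / (n : ℝ) ^ a)
  have hF : ∀ᶠ n : ℕ in atTop, ∫ x in (0 : ℝ)..1, F n ⌊(n : ℝ) * x⌋₊ =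
      (∑ l ∈ Finset.range n, 1 / √((l : ℝ) + 1) * u (n - 1 - l)) / (n : ℝ) ^ (a + 1 / 2) := by
    filter_upwards [eventually_gt_atTop 0] with n hn
    have hn' : (0 : ℝ) < n := Nat.cast_pos.2 hn
    rw [integral_floor_natCast_mul hn, Finset.sum_div, Finset.sum_div]
    refine Finset.sum_congr rfl fun l _ => ?_
    have hl : (0 : ℝ) < √((l : ℝ) + 1) := Real.sqrt_pos.2 (by positivity)
    have hs : (0 : ℝ) < √(n : ℝ) := Real.sqrt_pos.2 hn'
    have hp : (0 : ℝ) < (n : ℝ) ^ a := Real.rpow_pos_of_pos hn' a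
    simp only [F]
    rw [Real.rpow_add hn', ← Real.sqrt_eq_rpow, Real.sqrt_div (by positivity)]
    nth_rewrite 3 [← Real.mul_self_sqrt hn'.le]
    field_simp
  refine Tendsto.congr' hF ?_
  refine intervalIntegral.tendsto_integral_filter_of_dominated_convergence
    (fun x => 1 / √x * M) ?_ ?_ (intervalIntegrable_one_div_sqrt.mul_const M) ?_
  · refine Eventually.of_forall fun n => Measurable.aestronglyMeasurable ?_
    exact (measurable_from_nat (f := F n)).comp (Nat.measurable_floor.comp (by fun_prop))
  · filter_upwards [eventually_gt_atTop 0] with n hn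
    refine Eventually.of_forall fun x hx => ?_
    rw [Set.uIoc_of_le zero_le_one] at hx
    have hn' : (0 : ℝ) < n := Nat.cast_pos.2 hn
    have hp : (0 : ℝ) < (n : ℝ) ^ a := Real.rpow_pos_of_pos hn' a
    have hx0 : 0 < √x := Real.sqrt_pos.2 hx.1
    simp only [F, norm_mul, Real.norm_eq_abs, abs_div, abs_one, abs_of_pos hp,
      abs_of_nonneg (Real.sqrt_nonneg _)]
    gcongr
    · rw [le_div_iff₀ hn', mul_comm]
      exact (Nat.lt_floor_add_one _).le
    · rw [div_le_iff₀ hp]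
      exact hM n _ hn (by omega)
  · have hne : ∀ᵐ x : ℝ ∂volume, x ≠ 1 := volume.ae_ne 1
    filter_upwards [hne] with x hx1 hx
    rw [Set.uIoc_of_le zero_le_one] at hx
    have hx1 : x < 1 := lt_of_le_of_ne hx.2 hx1
    have hfl : Tendsto (fun n : ℕ => (⌊(n : ℝ) * x⌋₊ : ℝ) / n) atTop (𝓝 x) := by
      simpa only [mul_comm, Function.comp_def] using
        (tendsto_nat_floor_mul_div_atTop hx.1.le).comp (tendsto_natCast_atTop_atTop (R := ℝ))
    have hinv : Tendsto (fun n : ℕ => 1 / (n : ℝ)) atTop (𝓝 0) :=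
      tendsto_one_div_atTop_nhds_zero_nat
    have hlt : ∀ n : ℕ, 0 < n → ⌊(n : ℝ) * x⌋₊ < n := fun n hn => by
      have hn' : (0 : ℝ) < n := Nat.cast_pos.2 hn
      rw [Nat.floor_lt (by nlinarith [hx.1])]
      nlinarith
    let m : ℕ → ℕ := fun n => n - 1 - ⌊(n : ℝ) * x⌋₊
    have hmdiv : Tendsto (fun n : ℕ => (m n : ℝ) / n) atTop (𝓝 (1 - x)) := by
      have h : Tendsto (fun n : ℕ => 1 - 1 / (n : ℝ) - (⌊(n : ℝ) * x⌋₊ : ℝ) / n) atTop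
          (𝓝 (1 - 0 - x)) := (tendsto_const_nhds.sub hinv).sub hfl
      rw [sub_zero] at h
      refine h.congr' ?_
      filter_upwards [eventually_gt_atTop 0] with n hn
      have hn' : (0 : ℝ) < n := Nat.cast_pos.2 hn
      have h3 := hlt n hn
      have h4 : m n + ⌊(n : ℝ) * x⌋₊ + 1 = n := by simp only [m]; omega
      have h5 : (m n : ℝ) + ⌊(n : ℝ) * x⌋₊ + 1 = n := by exact_mod_cast h4
      field_simp
      linarith
    have hm : Tendsto m atTop atTop := by
      rw [← tendsto_natCast_atTop_iff (R := ℝ)]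
      refine (hmdiv.pos_mul_atTop (by linarith) (tendsto_natCast_atTop_atTop (R := ℝ))).congr' ?_
      filter_upwards [eventually_gt_atTop 0] with n hn
      have hn' : (n : ℝ) ≠ 0 := Nat.cast_ne_zero.2 hn.ne'
      field_simp
    have h1 : Tendsto (fun n : ℕ => 1 / √(((⌊(n : ℝ) * x⌋₊ : ℝ) + 1) / n)) atTop
        (𝓝 (1 / √x)) := by
      refine Tendsto.div tendsto_const_nhds ?_ (Real.sqrt_pos.2 hx.1).ne'
      refine (Real.continuous_sqrt.tendsto x).comp ?_
      simpa only [add_div, add_zero] using hfl.add hinv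
    have h2 : Tendsto (fun n : ℕ => u (m n) / (n : ℝ) ^ a) atTop (𝓝 (c * (1 - x) ^ a)) := by
      refine ((hu.comp hm).mul (hmdiv.rpow_const (Or.inr ha))).congr' ?_
      filter_upwards [hm.eventually_gt_atTop 0] with n hn
      have hmp : (0 : ℝ) < (m n : ℝ) ^ a := Real.rpow_pos_of_pos (Nat.cast_pos.2 hn) a
      rw [Function.comp_apply, Real.div_rpow (Nat.cast_nonneg _) (Nat.cast_nonneg _)]
      field_simp
    rw [mul_left_comm]
    exact h1.mul h2

theorem unitBallVol_succ (k : ℕ) :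
    unitBallVol (k + 1) =
      unitBallVol k * ProbabilityTheory.beta (1 / 2) ((k : ℝ) / 2 + 1) := by
  have h1 : Real.Gamma ((k : ℝ) / 2 + 1) ≠ 0 := (Real.Gamma_pos_of_pos (by positivity)).ne'
  have h2 : (1 : ℝ) / 2 + ((k : ℝ) / 2 + 1) = ((k + 1 : ℕ) : ℝ) / 2 + 1 := by push_cast; ring
  have h3 : ((k + 1 : ℕ) : ℝ) / 2 = (k : ℝ) / 2 + 1 / 2 := by push_cast; ring
  rw [unitBallVol, unitBallVol, ProbabilityTheory.beta, h2, Real.Gamma_one_half_eq, h3,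
    Real.rpow_add Real.pi_pos, ← Real.sqrt_eq_rpow]
  field_simp

theorem tendsto_sqrtRecipSumRec_div (k : ℕ) :
    Tendsto (fun n : ℕ => sqrtRecipSumRec k n / (n : ℝ) ^ ((k : ℝ) / 2)) atTop
      (𝓝 (unitBallVol k)) := by
  induction k with
  | zero => simp [sqrtRecipSumRec, unitBallVol]
  | succ k ih =>
    have h := tendsto_sum_one_div_sqrt_mul (by positivity) ih
    rw [← unitBallVol_succ] at h
    have h3 : ((k + 1 : ℕ) : ℝ) / 2 = (k : ℝ) / 2 + 1 / 2 := by push_cast; ring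
    simpa only [sqrtRecipSumRec, h3] using h

/-- `lim_{n→∞} n^{-k/2} Σ 1/√(l_1⋯l_k) = ω_k`, and consequently
`(1/√n)^k (1/k!) Σ 1/√(l_1⋯l_k) → ω_k / k!` as `n → ∞`. -/
theorem statement1 (k : ℕ) (hk : 1 ≤ k) :
    Tendsto (fun n : ℕ => (n : ℝ) ^ (-(k : ℝ) / 2) * sqrtRecipSum k n) atTop
      (𝓝 (unitBallVol k)) ∧
    Tendsto (fun n : ℕ =>
        (1 / Real.sqrt n) ^ k * ((1 / (Nat.factorial k : ℝ)) * sqrtRecipSum k n)) atTop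
      (𝓝 (unitBallVol k / (Nat.factorial k : ℝ))) := by
  have h : Tendsto (fun n : ℕ => (n : ℝ) ^ (-(k : ℝ) / 2) * sqrtRecipSum k n) atTop
      (𝓝 (unitBallVol k)) := by
    refine (tendsto_sqrtRecipSumRec_div k).congr fun n => ?_
    rw [sqrtRecipSum_eq_sqrtRecipSumRec, neg_div, Real.rpow_neg (Nat.cast_nonneg n), div_eq_inv_mul]
  refine ⟨h, (h.div_const (Nat.factorial k : ℝ)).congr fun n => ?_⟩
  have hn : (n : ℝ) ^ (-(k : ℝ) / 2) = (1 / √(n : ℝ)) ^ k := by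
    rw [neg_div, Real.rpow_neg (Nat.cast_nonneg n), one_div, inv_pow, Real.sqrt_eq_rpow,
      ← Real.rpow_mul_natCast (Nat.cast_nonneg n), one_div_mul_eq_div]
  rw [hn]
  ring
end

section
/- In L²([0, 1], Lebesgue measure), the closed convex hull of the set {B(t) : t ∈ [0, 1]}, where B(t) is the equivalence class of the indicator function of [0, t], equals the set of all f ∈ L²([0, 1]) that agree almost everywhere with a nonincreasing function taking values in [0, 1]. (This set is the Brownian motion body K_B.) -/
open MeasureTheory

/-- `B(t) ∈ L²([0,1])`: the (class of the) indicator function of the interval `[0, t]`. -/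
noncomputable def BM (t : ℝ) : Lp ℝ 2 (volume.restrict (Set.Icc (0 : ℝ) 1)) :=
  indicatorConstLp 2 (measurableSet_Icc : MeasurableSet (Set.Icc (0 : ℝ) t))
    (by
      refine ne_of_lt (lt_of_le_of_lt ?_ (?_ : volume (Set.Icc (0 : ℝ) 1) < ⊤))
      · rw [Measure.restrict_apply measurableSet_Icc]
        exact measure_mono Set.inter_subset_right
      · rw [Real.volume_Icc]
        exact ENNReal.ofReal_lt_top)
    (1 : ℝ)

open Filter

/-- The elements of `L²([0,1])` that agree almost everywhere with a nonincreasing function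
with values in `[0,1]`. -/
def antitoneBody : Set (Lp ℝ 2 (volume.restrict (Set.Icc (0 : ℝ) 1))) :=
  {f | ∃ g : ℝ → ℝ, AntitoneOn g (Set.Icc 0 1) ∧
    (∀ x ∈ Set.Icc (0 : ℝ) 1, g x ∈ Set.Icc (0 : ℝ) 1) ∧
    (f : ℝ → ℝ) =ᵐ[volume.restrict (Set.Icc (0 : ℝ) 1)] g}

lemma coeFn_BM (t : ℝ) :
    (BM t : ℝ → ℝ) =ᵐ[volume.restrict (Set.Icc (0 : ℝ) 1)]
      (Set.Icc (0 : ℝ) t).indicator fun _ => 1 :=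
  indicatorConstLp_coeFn

lemma BM_mem_antitoneBody (t : ℝ) : BM t ∈ antitoneBody := by
  refine ⟨_, fun x hx y hy hxy => ?_, fun x _ => ?_, coeFn_BM t⟩
  · simp only [Set.indicator_apply, Set.mem_Icc] at *
    grind
  · simp only [Set.indicator_apply]
    split_ifs <;> norm_num

lemma convex_antitoneBody : Convex ℝ antitoneBody := by
  rintro f ⟨g, hg, hg01, hfg⟩ f' ⟨g', hg', hg'01, hfg'⟩ a b ha hb hab
  refine ⟨a • g + b • g', fun x hx y hy hxy => ?_, fun x hx => ?_, ?_⟩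
  · have h := hg hx hy hxy
    have h' := hg' hx hy hxy
    simp only [Pi.add_apply, Pi.smul_apply, smul_eq_mul]
    gcongr
  · exact convex_Icc (0 : ℝ) 1 (hg01 x hx) (hg'01 x hx) ha hb hab
  · filter_upwards [hfg, hfg', Lp.coeFn_add (a • f) (b • f'), Lp.coeFn_smul a f,
      Lp.coeFn_smul b f'] with x h1 h2 h3 h4 h5
    rw [h3, Pi.add_apply, h4, h5]
    simp [h1, h2]

lemma isClosed_antitoneBody : IsClosed antitoneBody := by
  refine IsSeqClosed.isClosed fun F f hF hlim => ?_
  choose g hg hg01 hfg using hF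
  obtain ⟨ns, -, hns⟩ := (tendstoInMeasure_of_tendsto_Lp hlim).exists_seq_tendsto_ae
  have hle (x) (hx : x ∈ Set.Icc (0 : ℝ) 1) :
      IsBoundedUnder (· ≤ ·) atTop fun n => g (ns n) x :=
    isBoundedUnder_of ⟨1, fun n => (hg01 _ x hx).2⟩
  have hge (x) (hx : x ∈ Set.Icc (0 : ℝ) 1) :
      IsBoundedUnder (· ≥ ·) atTop fun n => g (ns n) x :=
    isBoundedUnder_of ⟨0, fun n => (hg01 _ x hx).1⟩
  refine ⟨fun x => limsup (fun n => g (ns n) x) atTop, fun x hx y hy hxy => ?_,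
    fun x hx => ⟨?_, ?_⟩, ?_⟩
  · exact limsup_le_limsup (Eventually.of_forall fun n => hg _ hx hy hxy)
      (hge y hy).isCoboundedUnder_le (hle x hx)
  · exact le_limsup_of_frequently_le (Frequently.of_forall fun n => (hg01 _ x hx).1) (hle x hx)
  · exact limsup_le_of_le (hge x hx).isCoboundedUnder_le
      (Eventually.of_forall fun n => (hg01 _ x hx).2)
  · filter_upwards [hns, ae_all_iff.2 hfg] with x hx hx'
    simp only [hx'] at hx
    exact hx.limsup_eq.symm

/-- Almost everywhere, a superlevel set of a nonincreasing function on `[0,1]` is some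
interval `[0, s]`. -/
lemma exists_BM_ae_eq_superlevel {g : ℝ → ℝ} (hg : AntitoneOn g (Set.Icc 0 1)) (c : ℝ) :
    ∃ s ∈ Set.Icc (0 : ℝ) 1, ∀ᵐ x ∂volume.restrict (Set.Icc (0 : ℝ) 1),
      (BM s : ℝ → ℝ) x = if c ≤ g x then 1 else 0 := by
  set S : Set ℝ := insert 0 {x | x ∈ Set.Icc (0 : ℝ) 1 ∧ c ≤ g x}
  have hS1 : ∀ x ∈ S, x ≤ 1 := by
    rintro x (rfl | hx)
    exacts [zero_le_one, hx.1.2]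
  have hbdd : BddAbove S := ⟨1, hS1⟩
  refine ⟨sSup S, ⟨le_csSup hbdd (Set.mem_insert _ _),
    csSup_le (Set.insert_nonempty _ _) hS1⟩, ?_⟩
  filter_upwards [coeFn_BM (sSup S), ae_restrict_mem measurableSet_Icc,
    Measure.ae_ne (volume.restrict (Set.Icc (0 : ℝ) 1)) (sSup S)] with x hx hx01 hne
  rw [hx, Set.indicator_apply]
  refine if_congr ⟨fun h => ?_, fun h => ?_⟩ rfl rfl
  · obtain ⟨y, hy, hxy⟩ :=
      exists_lt_of_lt_csSup (Set.insert_nonempty _ _) (lt_of_le_of_ne h.2 hne)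
    rcases hy with rfl | hy
    · exact absurd hxy hx01.1.not_gt
    · exact hy.2.trans (hg hx01 hy.1 hxy.le)
  · exact ⟨hx01.1, le_csSup hbdd (Or.inr ⟨hx01, h⟩)⟩

lemma sum_range_ite_succ_le_bounds (n : ℕ) {y : ℝ} (hy : 0 ≤ y) :
    min (y - 1) n ≤ ∑ k ∈ Finset.range n, (if (k : ℝ) + 1 ≤ y then (1 : ℝ) else 0) ∧
      ∑ k ∈ Finset.range n, (if (k : ℝ) + 1 ≤ y then (1 : ℝ) else 0) ≤ min y n := by
  induction n with
  | zero => simp [hy]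
  | succ n ih =>
    rw [Finset.sum_range_succ]
    push_cast
    grind

lemma antitoneBody_subset :
    antitoneBody ⊆ closure (convexHull ℝ (BM '' Set.Icc (0 : ℝ) 1)) := by
  rintro f ⟨g, hg, hg01, hfg⟩
  rw [Metric.mem_closure_iff]
  intro ε hε
  obtain ⟨m, hm⟩ := exists_nat_one_div_lt hε
  set n : ℝ := (m : ℝ) + 1 with hn
  have hn0 : 0 < n := by positivity
  choose s hs hBM using fun k : ℕ => exists_BM_ae_eq_superlevel hg (((k : ℝ) + 1) / n)
  refine ⟨∑ k ∈ Finset.range (m + 1), (1 / n) • BM (s k), ?_, ?_⟩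
  · refine (convex_convexHull ℝ _).sum_mem (fun _ _ => by positivity) ?_
      fun k _ => subset_convexHull ℝ _ ⟨s k, hs k, rfl⟩
    simp [← hn, hn0.ne']
  · rw [dist_eq_norm]
    refine lt_of_le_of_lt ?_ hm
    refine (Lp.norm_le_of_ae_bound (C := 1 / n) (by positivity) ?_).trans_eq ?_
    · filter_upwards [hfg, ae_restrict_mem measurableSet_Icc, ae_all_iff.2 hBM,
        Lp.coeFn_sub f (∑ k ∈ Finset.range (m + 1), (1 / n) • BM (s k)),
        Lp.coeFn_finsetSum (Finset.range (m + 1)) (fun k => (1 / n) • BM (s k)),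
        ae_all_iff.2 fun k => Lp.coeFn_smul (1 / n) (BM (s k))] with x h1 hx h2 h3 h4 h5
      have hgx := hg01 x hx
      obtain ⟨hl, hu⟩ := sum_range_ite_succ_le_bounds (m + 1) (mul_nonneg hgx.1 hn0.le)
      have hle : g x * n ≤ n := mul_le_of_le_one_left hn0.le hgx.2
      rw [h3, Pi.sub_apply, h4, h1]
      simp only [Finset.sum_apply, h5, Pi.smul_apply, h2, smul_eq_mul, div_le_iff₀ hn0,
        ← Finset.mul_sum]
      push_cast at hl hu
      rw [← hn, min_eq_left (by linarith)] at hl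
      rw [← hn, min_eq_left hle] at hu
      rw [Real.norm_eq_abs, abs_le]
      generalize (∑ k ∈ Finset.range (m + 1), (if (k : ℝ) + 1 ≤ g x * n then (1 : ℝ) else 0)) = S
        at hl hu ⊢
      have key : g x - 1 / n * S = (g x * n - S) * (1 / n) := by field_simp
      have hinv : 0 < 1 / n := by positivity
      rw [key]
      constructor <;> nlinarith
    · simp [measureUnivNNReal]

/-- in `L²([0,1])`, the closed convex hull of `{B(t) : t ∈ [0,1]}` (the
Brownian motion body) is the set of all `f` agreeing almost everywhere with a
nonincreasing function taking values in `[0,1]`. -/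
theorem statement17 :
    closure (convexHull ℝ (BM '' Set.Icc (0 : ℝ) 1)) =
    {f : Lp ℝ 2 (volume.restrict (Set.Icc (0 : ℝ) 1)) |
      ∃ g : ℝ → ℝ, AntitoneOn g (Set.Icc 0 1) ∧
        (∀ x ∈ Set.Icc (0 : ℝ) 1, g x ∈ Set.Icc (0 : ℝ) 1) ∧
        (f : ℝ → ℝ) =ᵐ[volume.restrict (Set.Icc (0 : ℝ) 1)] g} := by
  refine Set.Subset.antisymm (closure_minimal (convexHull_min ?_ convex_antitoneBody)
    isClosed_antitoneBody) antitoneBody_subset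
  rintro _ ⟨t, -, rfl⟩
  exact BM_mem_antitoneBody t
end
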